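/- Let X be a Polish, locally compact Hausdorff space, and let k : X × X → ℝ be a bounded continuous symmetric positive semidefinite kernel with 0 ≤ k(·,·) ≤ K for some K > 0, such that the MMD d_k is a metric on P(X) metrizing weak convergence. Let P, Q be Borel probability measures on X, let x_1, x_2, … be i.i.d. with law Q, fix α ∈ (0,1), and set γ_n = sqrt(2K/n)·(1 + sqrt(log(1/α))). Define the unbiased statistic d_u²(P, Q̂_n) = (1/(n(n−1))) ∑_{i=1}^n ∑_{j≠i} k(x_i,x_j) + ∫∫ k(y,y′) dP(y)dP(y′) − (2/n) ∑_{i=1}^n ∫ k(x_i,y) dP(y). Then: (1) if Q = P, for every n ≥ 2, Prob(d_u²(P, Q̂_n) > γ_n² + K/n) ≤ α; and (2) if 0 < D(P‖Q) < ∞, then liminf_{n→∞} −(1/n) log Prob(d_u²(P, Q̂_n) ≤ γ_n² + K/n) = D(P‖Q). -/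

import Mathlib

open MeasureTheory Filter Topology ENNReal
open scoped Classical

noncomputable section
/-- The Kullback-Leibler divergence `D(P‖Q) ∈ [0,∞]`: it equals `∫ log (dP/dQ) dP` when
`P ≪ Q` (and the integral is well defined), and `+∞` otherwise. -/
def klDiv {X : Type*} [MeasurableSpace X] (P Q : Measure X) : ℝ≥0∞ :=
  if P ≪ Q ∧ Integrable (llr P Q) P then ENNReal.ofReal (∫ x, llr P Q x ∂P) else ⊤
/-- The empirical measure `(1/n) ∑_{i<n} δ_{x i}` of a sample, as a probability measure
(junk value for `n = 0`). -/
def empMeas {X : Type*} [MeasurableSpace X] [Nonempty X] (n : ℕ) (x : Fin n → X) :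
    ProbabilityMeasure X :=
  if h : 0 < n then
    ⟨(n : ℝ≥0∞)⁻¹ • ∑ i, Measure.dirac (x i), by
      constructor
      simp only [Measure.smul_apply, smul_eq_mul, Measure.coe_finset_sum, Finset.sum_apply,
        measure_univ, Finset.sum_const, Finset.card_univ, Fintype.card_fin, nsmul_eq_mul, mul_one]
      exact ENNReal.inv_mul_cancel (by exact_mod_cast h.ne') (by simp)⟩
  else ⟨Measure.dirac (Classical.arbitrary X), inferInstance⟩
/-- The squared Maximum Mean Discrepancy associated with the kernel `k`. -/
def mmdSq {X : Type*} [MeasurableSpace X] (k : X → X → ℝ) (P Q : Measure X) : ℝ :=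
  (∫ y, ∫ y', k y y' ∂P ∂P) + (∫ x, ∫ x', k x x' ∂Q ∂Q) - 2 * ∫ y, ∫ x, k y x ∂Q ∂P

/-- The Maximum Mean Discrepancy `d_k`, the nonnegative square root of `mmdSq`. -/
def mmd {X : Type*} [MeasurableSpace X] (k : X → X → ℝ) (P Q : Measure X) : ℝ :=
  Real.sqrt (mmdSq k P Q)
/-- The exponential decay rate `-(1/n) log p` of a probability `p`, valued in `EReal`
(with `-(1/n) log 0 = ⊤`). -/
def expRate (n : ℕ) (p : ℝ≥0∞) : EReal := -((((n : ℝ)⁻¹ : ℝ) : EReal) * ENNReal.log p)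

/-- The unbiased estimator `d_u²(P, Q̂_n)` of the squared MMD, computed from the sample `x`. -/
def duSqSimple {X : Type*} [MeasurableSpace X] (k : X → X → ℝ) (P : Measure X) {n : ℕ}
    (x : Fin n → X) : ℝ :=
  ((n : ℝ) * ((n : ℝ) - 1))⁻¹ *
      ∑ i, ∑ j ∈ Finset.univ.filter (fun j => j ≠ i), k (x i) (x j)
    + (∫ y, ∫ y', k y y' ∂P ∂P)
    - (2 / (n : ℝ)) * ∑ i, ∫ y, k (x i) y ∂P

/-- The moment generating function bound behind McDiarmid's inequality. -/
lemma integral_exp_le_of_bounded_differences {X : Type*} [MeasurableSpace X] (μ : Measure X)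
    [IsProbabilityMeasure μ] (c s B : ℝ) (n : ℕ) (f : (Fin n → X) → ℝ)
    (hf : Measurable f) (hB : ∀ x, |f x| ≤ B)
    (hd : ∀ x i a, |f (Function.update x i a) - f x| ≤ c) :
    ∫ x, Real.exp (s * f x) ∂(Measure.pi fun _ : Fin n => μ)
      ≤ Real.exp (s * ∫ x, f x ∂(Measure.pi fun _ : Fin n => μ) + s ^ 2 * (n * c ^ 2) / 8) := by
  induction n with
  | zero =>
    have h : ∀ x, f x = f Fin.elim0 := fun x => congrArg f (Subsingleton.elim _ _)
    simp [h]
  | succ n ih =>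
    let e := MeasurableEquiv.piFinSuccAbove (fun _ : Fin (n + 1) => X) 0
    have hmp := (measurePreserving_piFinSuccAbove (fun _ : Fin (n + 1) => μ) 0).symm
    have he : ∀ a y, e.symm (a, y) = Fin.cons a y := fun a y => by
      simp [e, MeasurableEquiv.piFinSuccAbove]
      rfl
    set ν := Measure.pi fun _ : Fin n => μ
    have hmcons : Measurable fun p : X × (Fin n → X) => f (Fin.cons p.1 p.2) := by
      convert hf.comp e.symm.measurable using 2 with p
      exact congrArg f (he p.1 p.2).symm
    have hmcons' : ∀ a, Measurable fun y : Fin n → X => f (Fin.cons a y) := fun a =>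
      hmcons.comp measurable_prodMk_left
    have key : ∀ h : ℝ → ℝ, Measurable h → Integrable (fun p : X × (Fin n → X) =>
        h (f (Fin.cons p.1 p.2))) (μ.prod ν) →
        ∫ x, h (f x) ∂(Measure.pi fun _ : Fin (n + 1) => μ)
          = ∫ a, ∫ y, h (f (Fin.cons a y)) ∂ν ∂μ := by
      intro h hh hi
      rw [← integral_prod (fun p : X × (Fin n → X) => h (f (Fin.cons p.1 p.2))) hi]
      rw [← hmp.integral_comp']
      refine integral_congr_ae (ae_of_all _ fun p => ?_)
      exact congrArg (fun z => h (f z)) (he p.1 p.2)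
    have hexpB : ∀ z, |Real.exp (s * f z)| ≤ Real.exp (|s| * B) := fun z => by
      rw [abs_of_pos (Real.exp_pos _), Real.exp_le_exp]
      calc s * f z ≤ |s * f z| := le_abs_self _
        _ = |s| * |f z| := abs_mul _ _
        _ ≤ |s| * B := by gcongr; exact hB z
    have hi1 : Integrable (fun p : X × (Fin n → X) => f (Fin.cons p.1 p.2)) (μ.prod ν) :=
      Integrable.of_bound hmcons.aestronglyMeasurable B (ae_of_all _ fun p => hB _)
    have hi2 : Integrable (fun p : X × (Fin n → X) => Real.exp (s * f (Fin.cons p.1 p.2)))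
        (μ.prod ν) :=
      Integrable.of_bound (hmcons.const_mul s).exp.aestronglyMeasurable (Real.exp (|s| * B))
        (ae_of_all _ fun p => hexpB _)
    rw [key (fun t => Real.exp (s * t)) (by fun_prop) hi2, key (fun t => t) measurable_id hi1]
    set g : X → ℝ := fun a => ∫ y, f (Fin.cons a y) ∂ν with hg
    have hgm : Measurable g := hmcons.stronglyMeasurable.integral_prod_right.measurable
    have hfi : ∀ a, Integrable (fun y => f (Fin.cons a y)) ν := fun a =>
      Integrable.of_bound (hmcons' a).aestronglyMeasurable B (ae_of_all _ fun p => hB _)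
    have hgd : ∀ a b, g a ≤ g b + c := by
      intro a b
      have : g a ≤ ∫ y, (f (Fin.cons b y) + c) ∂ν := by
        refine integral_mono (hfi a) ((hfi b).add (integrable_const c)) fun y => ?_
        have := hd (Fin.cons b y) 0 a
        rw [Fin.update_cons_zero] at this
        linarith [le_abs_self (f (Fin.cons a y) - f (Fin.cons b y))]
      rw [integral_add (hfi b) (integrable_const c)] at this
      simpa using this
    have hgB : ∀ a, |g a| ≤ B := fun a => by
      have := norm_integral_le_of_norm_le_const (μ := ν) (f := fun y => f (Fin.cons a y))
        (ae_of_all _ fun y => hB _)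
      simpa using this
    have hgI : ∀ᵐ a ∂μ, g a ∈ Set.Icc (sInf (Set.range g)) (sInf (Set.range g) + c) := by
      have hbdd : BddBelow (Set.range g) := ⟨-B, by
        rintro _ ⟨a, rfl⟩; exact (abs_le.1 (hgB a)).1⟩
      refine ae_of_all _ fun a => ⟨csInf_le hbdd ⟨a, rfl⟩, ?_⟩
      rw [← sub_le_iff_le_add]
      refine le_csInf ⟨_, a, rfl⟩ ?_
      rintro _ ⟨b, rfl⟩
      linarith [hgd a b]
    have hhoeff := (ProbabilityTheory.hasSubgaussianMGF_of_mem_Icc hgm.aemeasurable hgI).mgf_le s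
    have h1 : ∫ a, Real.exp (s * g a) ∂μ
        ≤ Real.exp (s * ∫ a, g a ∂μ) * Real.exp (s ^ 2 * c ^ 2 / 8) := by
      rw [ProbabilityTheory.mgf] at hhoeff
      have h2 : ∀ a, Real.exp (s * g a)
          = Real.exp (s * ∫ a, g a ∂μ) * Real.exp (s * (g a - ∫ a, g a ∂μ)) := fun a => by
        rw [← Real.exp_add]; ring_nf
      simp_rw [h2]
      rw [integral_const_mul]
      gcongr
      refine hhoeff.trans (le_of_eq ?_)
      congr 1
      push_cast
      rw [add_sub_cancel_left, Real.norm_eq_abs, div_pow, sq_abs]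
      ring
    calc ∫ a, ∫ y, Real.exp (s * f (Fin.cons a y)) ∂ν ∂μ
        ≤ ∫ a, Real.exp (s * g a) * Real.exp (s ^ 2 * (n * c ^ 2) / 8) ∂μ := by
          refine integral_mono hi2.integral_prod_left ?_ fun a => ?_
          · refine Integrable.of_bound (by fun_prop)
              (Real.exp (|s| * B) * Real.exp (s ^ 2 * (n * c ^ 2) / 8)) (ae_of_all _ fun a => ?_)
            rw [Real.norm_eq_abs, abs_of_pos (by positivity), ← abs_of_pos (Real.exp_pos (s * g a))]
            gcongr
            rw [abs_of_pos (Real.exp_pos _), Real.exp_le_exp]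
            calc s * g a ≤ |s * g a| := le_abs_self _
              _ = |s| * |g a| := abs_mul _ _
              _ ≤ |s| * B := by gcongr; exact hgB a
          · have := ih (fun y => f (Fin.cons a y)) (hmcons' a) (fun y => hB _) fun x i b => by
              have := hd (Fin.cons a x) i.succ b
              rwa [← Fin.cons_update] at this
            rwa [Real.exp_add] at this
      _ ≤ _ := by
          rw [integral_mul_const]
          calc _ ≤ Real.exp (s * ∫ a, g a ∂μ) * Real.exp (s ^ 2 * c ^ 2 / 8)
                * Real.exp (s ^ 2 * (n * c ^ 2) / 8) := by gcongr
            _ = _ := by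
              rw [← Real.exp_add, ← Real.exp_add]
              congr 1
              push_cast
              ring

/-- **McDiarmid's inequality** for functions on a finite power of a probability space. -/
lemma measure_pi_ge_le_of_bounded_differences {X : Type*} [MeasurableSpace X] (μ : Measure X)
    [IsProbabilityMeasure μ] (c : ℝ) {s : ℝ} (hs : 0 ≤ s) (B t : ℝ) (n : ℕ)
    (f : (Fin n → X) → ℝ) (hf : Measurable f) (hB : ∀ x, |f x| ≤ B)
    (hd : ∀ x i a, |f (Function.update x i a) - f x| ≤ c) :
    (Measure.pi fun _ : Fin n => μ) {x | ∫ x, f x ∂(Measure.pi fun _ : Fin n => μ) + t ≤ f x}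
      ≤ ENNReal.ofReal (Real.exp (-s * t + s ^ 2 * (n * c ^ 2) / 8)) := by
  set ν := Measure.pi fun _ : Fin n => μ
  have hint : Integrable (fun x => Real.exp (s * f x)) ν := by
    refine Integrable.of_bound (by fun_prop) (Real.exp (s * B)) (ae_of_all _ fun x => ?_)
    rw [Real.norm_eq_abs, abs_of_pos (Real.exp_pos _), Real.exp_le_exp]
    gcongr
    exact (abs_le.1 (hB x)).2
  rw [← ofReal_measureReal]
  refine ENNReal.ofReal_le_ofReal ?_
  refine (ProbabilityTheory.measure_ge_le_exp_mul_mgf _ hs hint).trans ?_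
  calc _ ≤ Real.exp (-s * (∫ x, f x ∂ν + t))
        * Real.exp (s * ∫ x, f x ∂ν + s ^ 2 * (n * c ^ 2) / 8) := by
        gcongr
        exact integral_exp_le_of_bounded_differences μ c s B n f hf hB hd
    _ = _ := by
        rw [← Real.exp_add]
        ring_nf

/-- The weak law of large numbers on finite powers of a probability space. -/
lemma tendsto_measure_pi_sum_gt {X : Type*} [MeasurableSpace X] (P : Measure X)
    [IsProbabilityMeasure P] {f : X → ℝ} (hfm : Measurable f) (hf : Integrable f P) {c : ℝ}
    (hc : ∫ x, f x ∂P < c) :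
    Tendsto (fun n : ℕ => (Measure.pi fun _ : Fin n => P) {x | n * c < ∑ i, f (x i)})
      atTop (𝓝 0) := by
  let μ := Measure.infinitePi fun _ : ℕ => P
  have hev : ∀ i, MeasurePreserving (fun ω : ℕ → X => ω i) μ P := fun i =>
    measurePreserving_eval_infinitePi (fun _ : ℕ => P) i
  have hind : ProbabilityTheory.iIndepFun (fun (i : ℕ) (ω : ℕ → X) => f (ω i)) μ :=
    ProbabilityTheory.iIndepFun_infinitePi (P := fun _ : ℕ => P) (X := fun _ => f) fun _ => hfm
  have hident : ∀ i, ProbabilityTheory.IdentDistrib (fun ω : ℕ → X => f (ω i))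
      (fun ω : ℕ → X => f (ω 0)) μ μ := fun i => by
    have h : ProbabilityTheory.IdentDistrib (fun ω : ℕ → X => ω i) (fun ω : ℕ → X => ω 0) μ μ :=
      ⟨(hev i).measurable.aemeasurable, (hev 0).measurable.aemeasurable,
        (hev i).map_eq.trans (hev 0).map_eq.symm⟩
    exact h.comp hfm
  have hlaw := ProbabilityTheory.strong_law_ae_real (μ := μ) (fun i ω => f (ω i))
    ((hev 0).integrable_comp_of_integrable hf) (fun i j hij => hind.indepFun hij) hident
  have hmean : ∫ ω, f (ω 0) ∂μ = ∫ x, f x ∂P := by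
    rw [← (hev 0).map_eq, integral_map (hev 0).measurable.aemeasurable
      hfm.aestronglyMeasurable]
  rw [hmean] at hlaw
  have hmeas : ∀ n : ℕ, Measurable fun ω : ℕ → X => (∑ i ∈ Finset.range n, f (ω i)) / n :=
    fun n => by fun_prop
  have hprob := tendstoInMeasure_of_tendsto_ae (fun n => (hmeas n).aestronglyMeasurable) hlaw
  have hlim := hprob (ENNReal.ofReal (c - ∫ x, f x ∂P)) (by simpa using hc)
  refine tendsto_of_tendsto_of_tendsto_of_le_of_le tendsto_const_nhds hlim (fun _ => zero_le)
    fun n => ?_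
  have hmap : μ.map (fun ω (i : Fin n) => ω i) = Measure.pi fun _ : Fin n => P := by
    rw [← Measure.infinitePi_eq_pi]
    exact Measure.map_infinitePi_infinitePi_of_inj (P := fun _ : ℕ => P) Fin.val_injective
  simp only
  rw [← hmap, Measure.map_apply (by fun_prop) (measurableSet_lt (by fun_prop) (by fun_prop))]
  refine measure_mono fun ω hω => ?_
  simp only [Set.mem_preimage, Set.mem_ofPred_eq] at hω ⊢
  have hn : (0 : ℝ) < n := by
    rcases Nat.eq_zero_or_pos n with rfl | h
    · simp at hω
    · exact_mod_cast h
  rw [Fin.sum_univ_eq_sum_range (fun i => f (ω i)) n] at hω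
  rw [edist_dist, Real.dist_eq]
  refine ENNReal.ofReal_le_ofReal ((sub_le_sub_right ?_ _).trans (le_abs_self _))
  rw [le_div_iff₀ hn]
  linarith

/-- Finite powers commute with densities. -/
lemma pi_withDensity {X : Type*} [MeasurableSpace X] (Q : Measure X)
    [IsProbabilityMeasure Q] {r : X → ℝ} (hr0 : ∀ x, 0 ≤ r x)
    (hri : Integrable r Q) (n : ℕ) :
    (Measure.pi fun _ : Fin n => Q.withDensity fun x => ENNReal.ofReal (r x))
      = (Measure.pi fun _ : Fin n => Q).withDensity fun x => ENNReal.ofReal (∏ i, r (x i)) := by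
  have := isFiniteMeasure_withDensity_ofReal hri.2
  refine Measure.pi_eq (μ := fun _ : Fin n => Q.withDensity fun x => ENNReal.ofReal (r x))
    fun s hs => ?_
  rw [withDensity_apply _ (MeasurableSet.univ_pi hs)]
  have hind : ∀ i, Integrable ((s i).indicator r) Q := fun i => hri.indicator (hs i)
  have hind0 : ∀ i x, 0 ≤ (s i).indicator r x := fun i x =>
    Set.indicator_nonneg (fun y _ => hr0 y) x
  have h1 : ∀ i, Q.withDensity (fun x => ENNReal.ofReal (r x)) (s i)
      = ENNReal.ofReal (∫ x, (s i).indicator r x ∂Q) := fun i => by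
    rw [withDensity_apply _ (hs i), integral_indicator (hs i),
      ofReal_integral_eq_lintegral_ofReal hri.integrableOn (ae_of_all _ hr0)]
  simp_rw [h1]
  rw [← ENNReal.ofReal_prod_of_nonneg fun i _ => integral_nonneg (hind0 i),
    ← integral_fintype_prod_eq_prod, ofReal_integral_eq_lintegral_ofReal
      (Integrable.fintype_prod_dep hind)
      (ae_of_all _ fun x => Finset.prod_nonneg fun i _ => hind0 i _),
    ← lintegral_indicator (MeasurableSet.univ_pi hs)]
  refine lintegral_congr fun x => ?_
  by_cases hx : x ∈ Set.univ.pi s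
  · rw [Set.indicator_of_mem hx]
    congr 1
    exact Finset.prod_congr rfl fun i _ => by rw [Set.indicator_of_mem (hx i trivial)]
  · rw [Set.indicator_of_notMem hx]
    obtain ⟨i, hi⟩ : ∃ i, x i ∉ s i := by simpa [Set.mem_pi] using hx
    rw [Finset.prod_eq_zero (Finset.mem_univ i) (by rw [Set.indicator_of_notMem hi]),
      ENNReal.ofReal_zero]

/-- Change of measure on an event where the log-likelihood ratio is at most `n * c`. -/
lemma measure_pi_inter_llr_le {X : Type*} [MeasurableSpace X] (P Q : Measure X)
    [IsProbabilityMeasure P] [IsProbabilityMeasure Q] (hPQ : P ≪ Q) (n : ℕ) (c : ℝ)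
    {A : Set (Fin n → X)} (hA : MeasurableSet A) :
    (Measure.pi fun _ : Fin n => P) (A ∩ {x | ∑ i, llr P Q (x i) ≤ n * c})
      ≤ ENNReal.ofReal (Real.exp (n * c)) * (Measure.pi fun _ : Fin n => Q) A := by
  let r : X → ℝ := fun x => (P.rnDeriv Q x).toReal
  have hr : Measurable r := (Measure.measurable_rnDeriv P Q).ennreal_toReal
  have hP : P = Q.withDensity fun x => ENNReal.ofReal (r x) := by
    conv_lhs => rw [← Measure.withDensity_rnDeriv_eq P Q hPQ]
    refine withDensity_congr_ae ?_
    filter_upwards [Measure.rnDeriv_lt_top P Q] with x hx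
    exact (ENNReal.ofReal_toReal hx.ne).symm
  have hB : MeasurableSet {x : Fin n → X | ∑ i, llr P Q (x i) ≤ n * c} := by
    have := measurable_llr P Q
    exact measurableSet_le (by fun_prop) (by fun_prop)
  have hpi : (Measure.pi fun _ : Fin n => P)
      = (Measure.pi fun _ : Fin n => Q).withDensity fun x => ENNReal.ofReal (∏ i, r (x i)) := by
    rw [← pi_withDensity Q (fun _ => ENNReal.toReal_nonneg) Measure.integrable_toReal_rnDeriv,
      ← hP]
  rw [hpi, withDensity_apply _ (hA.inter hB)]
  calc _ ≤ ∫⁻ _ in A ∩ {x | ∑ i, llr P Q (x i) ≤ n * c},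
        ENNReal.ofReal (Real.exp (n * c)) ∂(Measure.pi fun _ : Fin n => Q) := by
        refine setLIntegral_mono' (hA.inter hB) fun x hx => ENNReal.ofReal_le_ofReal ?_
        by_cases h : ∃ i, r (x i) = 0
        · obtain ⟨i, hi⟩ := h
          rw [Finset.prod_eq_zero (Finset.mem_univ i) hi]
          positivity
        · push Not at h
          have hpos : ∀ i, 0 < r (x i) := fun i => lt_of_le_of_ne ENNReal.toReal_nonneg (h i).symm
          have : ∏ i, r (x i) = Real.exp (∑ i, llr P Q (x i)) := by
            rw [Real.exp_sum]
            exact Finset.prod_congr rfl fun i _ => (Real.exp_log (hpos i)).symm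
          rw [this, Real.exp_le_exp]
          exact hx.2
    _ ≤ _ := by
        rw [setLIntegral_const]
        gcongr
        exact Set.inter_subset_left

/-- Bounded continuous functions nearly attain the supremum in the Donsker-Varadhan formula. -/
lemma exists_boundedContinuous_integral_llr_le {X : Type*} [MeasurableSpace X]
    [TopologicalSpace X] [PolishSpace X] [BorelSpace X] (P Q : Measure X)
    [IsProbabilityMeasure P] [IsProbabilityMeasure Q] (hPQ : P ≪ Q)
    (hint : Integrable (llr P Q) P) {δ : ℝ} (hδ : 0 < δ) :
    ∃ f : BoundedContinuousFunction X ℝ,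
      ∫ x, Real.exp (f x) ∂Q ≤ 1 + δ ∧ ∫ x, llr P Q x ∂P - δ ≤ ∫ x, f x ∂P := by
  let r : X → ℝ := fun x => (P.rnDeriv Q x).toReal
  have hr : Measurable r := (Measure.measurable_rnDeriv P Q).ennreal_toReal
  have hlm : Measurable (llr P Q) := measurable_llr P Q
  let g : ℕ → X → ℝ := fun M x => if r x = 0 then -(M : ℝ) else max (-(M : ℝ)) (min M (llr P Q x))
  have hgm : ∀ M, Measurable (g M) := fun M =>
    Measurable.ite (hr (measurableSet_singleton 0)) measurable_const (by fun_prop)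
  have hgB : ∀ (M : ℕ) x, -(M : ℝ) ≤ g M x ∧ g M x ≤ M := fun M x => by
    have : (0 : ℝ) ≤ M := Nat.cast_nonneg M
    simp only [g]
    split_ifs
    · constructor <;> linarith
    · exact ⟨le_max_left _ _, max_le (by linarith) (min_le_left _ _)⟩
  have hexp : ∀ M x, Real.exp (g M x) ≤ r x + Real.exp (-(M : ℝ)) := fun M x => by
    have hr0 : 0 ≤ r x := ENNReal.toReal_nonneg
    simp only [g]
    split_ifs with h
    · linarith
    · rcases le_total (-(M : ℝ)) (min M (llr P Q x)) with h' | h'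
      · rw [max_eq_right h']
        have : Real.exp (llr P Q x) = r x := Real.exp_log (lt_of_le_of_ne hr0 (Ne.symm h))
        have := Real.exp_le_exp.2 (min_le_right (M : ℝ) (llr P Q x))
        have := Real.exp_pos (-(M : ℝ))
        linarith
      · rw [max_eq_left h']
        linarith
  have hpos : ∀ᵐ x ∂P, 0 < (P.rnDeriv Q x).toReal := by
    filter_upwards [Measure.rnDeriv_pos hPQ, hPQ.ae_le (Measure.rnDeriv_lt_top P Q)] with x h1 h2
    exact ENNReal.toReal_pos h1.ne' h2.ne
  have hlim : Tendsto (fun M => ∫ x, g M x ∂P) atTop (𝓝 (∫ x, llr P Q x ∂P)) := by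
    refine tendsto_integral_of_dominated_convergence (fun x => |llr P Q x|)
      (fun M => (hgm M).aestronglyMeasurable) hint.abs (fun M => ?_) ?_
    · filter_upwards [hpos] with x hx
      simp only [g, r, if_neg hx.ne', Real.norm_eq_abs]
      have : (0 : ℝ) ≤ M := Nat.cast_nonneg M
      rw [abs_le]
      constructor
      · exact le_max_of_le_right (le_min (by linarith [abs_nonneg (llr P Q x)]) (neg_abs_le _))
      · exact max_le (by linarith [abs_nonneg (llr P Q x)])
          ((min_le_right _ _).trans (le_abs_self _))
    · filter_upwards [hpos] with x hx
      refine tendsto_const_nhds.congr' ?_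
      filter_upwards [eventually_ge_atTop ⌈|llr P Q x|⌉₊] with M hM
      have hM' : |llr P Q x| ≤ M := (Nat.le_ceil _).trans (by exact_mod_cast hM)
      rw [abs_le] at hM'
      simp only [g, r, if_neg hx.ne']
      rw [min_eq_right hM'.2, max_eq_right hM'.1]
  have hsmall : Tendsto (fun M : ℕ => Real.exp (-(M : ℝ))) atTop (𝓝 0) :=
    Real.tendsto_exp_neg_atTop_nhds_zero.comp tendsto_natCast_atTop_atTop
  obtain ⟨M, hM1, hM2⟩ := ((hlim.eventually (lt_mem_nhds (sub_lt_self _ (half_pos hδ)))).and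
    (hsmall.eventually (gt_mem_nhds (half_pos hδ)))).exists
  have hM0 : (0 : ℝ) ≤ M := Nat.cast_nonneg M
  have hgi : ∀ (μ : Measure X) [IsFiniteMeasure μ], Integrable (g M) μ := fun μ _ =>
    Integrable.of_bound (hgm M).aestronglyMeasurable M (ae_of_all _ fun x => abs_le.2 (hgB M x))
  obtain ⟨h, hh, hhi⟩ := (hgi (P + Q)).exists_boundedContinuous_integral_sub_le
    (ε := δ / 2 * Real.exp (-(M : ℝ))) (by positivity)
  let f : BoundedContinuousFunction X ℝ := BoundedContinuousFunction.ofNormedAddCommGroup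
    (fun x => max (-(M : ℝ)) (min M (h x))) (by fun_prop) M fun x =>
      abs_le.2 ⟨le_max_left _ _, max_le (by linarith) (min_le_left _ _)⟩
  have hf : ∀ x, f x = max (-(M : ℝ)) (min M (h x)) := fun x => rfl
  have hfM : ∀ x, f x ≤ M := fun x => max_le (by linarith) (min_le_left _ _)
  have hfg : ∀ x, |g M x - f x| ≤ ‖g M x - h x‖ := fun x => by
    have h1 : g M x = max (-(M : ℝ)) (min M (g M x)) := by
      rw [min_eq_right (hgB M x).2, max_eq_right (hgB M x).1]
    rw [hf, Real.norm_eq_abs]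
    conv_lhs => rw [h1]
    refine (abs_max_sub_max_le_max _ _ _ _).trans ?_
    rw [sub_self, abs_zero, max_eq_right (abs_nonneg _)]
    refine (abs_min_sub_min_le_max _ _ _ _).trans ?_
    rw [sub_self, abs_zero, max_eq_right (abs_nonneg _)]
  have hghi : ∀ (μ : Measure X) [IsFiniteMeasure μ], Integrable (fun x => ‖g M x - h x‖) μ :=
    fun μ _ => ((hgi μ).sub (h.integrable μ)).norm
  rw [integral_add_measure (hghi P) (hghi Q)] at hh
  have hP0 : 0 ≤ ∫ x, ‖g M x - h x‖ ∂P := integral_nonneg fun _ => norm_nonneg _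
  have hQ0 : 0 ≤ ∫ x, ‖g M x - h x‖ ∂Q := integral_nonneg fun _ => norm_nonneg _
  refine ⟨f, ?_, ?_⟩
  · have hri : Integrable r Q := Measure.integrable_toReal_rnDeriv
    have hr1 : ∫ x, r x ∂Q = 1 := by
      simp [r, Measure.integral_toReal_rnDeriv hPQ]
    have hpt : ∀ x, Real.exp (f x)
        ≤ r x + Real.exp (-(M : ℝ)) + Real.exp M * ‖g M x - h x‖ := fun x => by
      have h1 : Real.exp (f x) - Real.exp (g M x) ≤ Real.exp (f x) * |g M x - f x| := by
        have h2 : Real.exp (g M x) = Real.exp (f x) * Real.exp (g M x - f x) := by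
          rw [← Real.exp_add]; ring_nf
        have h3 := Real.add_one_le_exp (g M x - f x)
        have h4 := neg_abs_le (g M x - f x)
        have h5 : -Real.exp (g M x - f x) + 1 ≤ |g M x - f x| := by linarith
        have := mul_le_mul_of_nonneg_left h5 (Real.exp_pos (f x)).le
        rw [h2]
        linarith
      have h6 : Real.exp (f x) * |g M x - f x| ≤ Real.exp M * ‖g M x - h x‖ := by
        gcongr
        · exact hfM x
        · exact hfg x
      linarith [hexp M x]
    have hi1 : Integrable (fun x => r x + Real.exp (-(M : ℝ))) Q :=
      hri.add (integrable_const _)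
    have hi2 : Integrable (fun x => Real.exp M * ‖g M x - h x‖) Q := (hghi Q).const_mul _
    calc ∫ x, Real.exp (f x) ∂Q
        ≤ ∫ x, (r x + Real.exp (-(M : ℝ)) + Real.exp M * ‖g M x - h x‖) ∂Q := by
          refine integral_mono ?_ (hi1.add hi2) hpt
          refine Integrable.of_bound (by fun_prop) (Real.exp M) (ae_of_all _ fun x => ?_)
          rw [Real.norm_eq_abs, abs_of_pos (Real.exp_pos _), Real.exp_le_exp]
          exact hfM x
      _ = 1 + Real.exp (-(M : ℝ)) + Real.exp M * ∫ x, ‖g M x - h x‖ ∂Q := by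
          rw [integral_add hi1 hi2, integral_add hri (integrable_const _), hr1,
            integral_const_mul]
          simp
      _ ≤ 1 + δ := by
          have : Real.exp M * ∫ x, ‖g M x - h x‖ ∂Q
              ≤ Real.exp M * (δ / 2 * Real.exp (-(M : ℝ))) := by
            gcongr
            linarith
          have h7 : Real.exp M * (δ / 2 * Real.exp (-(M : ℝ))) = δ / 2 := by
            rw [mul_left_comm, ← Real.exp_add]
            simp
          linarith
  · have h1 : ∫ x, g M x ∂P - ∫ x, f x ∂P ≤ ∫ x, ‖g M x - h x‖ ∂P := by
      rw [← integral_sub (hgi P) (f.integrable P)]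
      exact integral_mono ((hgi P).sub (f.integrable P)) (hghi P) fun x =>
        (le_abs_self _).trans (hfg x)
    have h2 : δ / 2 * Real.exp (-(M : ℝ)) ≤ δ / 2 * 1 := by
      gcongr
      exact Real.exp_le_one_iff.2 (by linarith)
    linarith

/-- The Chernoff bound for sums over a finite power of a probability space. -/
lemma measure_pi_sum_ge_le {X : Type*} [MeasurableSpace X] (Q : Measure X)
    [IsProbabilityMeasure Q] {f : X → ℝ} (hf : Integrable (fun x => Real.exp (f x)) Q)
    (a : ℝ) (n : ℕ) :
    (Measure.pi fun _ : Fin n => Q) {x | a ≤ ∑ i, f (x i)}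
      ≤ ENNReal.ofReal (Real.exp (-a) * (∫ x, Real.exp (f x) ∂Q) ^ n) := by
  have hprod : ∀ x : Fin n → X, Real.exp (1 * ∑ i, f (x i)) = ∏ i, Real.exp (f (x i)) :=
    fun x => by rw [one_mul, Real.exp_sum]
  have h := ProbabilityTheory.measure_ge_le_exp_mul_mgf (μ := Measure.pi fun _ : Fin n => Q)
    (X := fun x => ∑ i, f (x i)) a zero_le_one (by
      simp_rw [hprod]
      exact Integrable.fintype_prod fun _ => hf)
  rw [ProbabilityTheory.mgf] at h
  simp_rw [hprod] at h
  rw [integral_fintype_prod_eq_pow (fun x => Real.exp (f x)), Fintype.card_fin, neg_one_mul] at h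
  rw [← ofReal_measureReal]
  exact ENNReal.ofReal_le_ofReal h

lemma integral_empMeas {X : Type*} [MeasurableSpace X] [MeasurableSingletonClass X] [Nonempty X]
    {n : ℕ} (hn : 0 < n) (x : Fin n → X) (g : X → ℝ) :
    ∫ y, g y ∂(empMeas n x : Measure X) = (n : ℝ)⁻¹ * ∑ i, g (x i) := by
  have h : (empMeas n x : Measure X) = (n : ℝ≥0∞)⁻¹ • ∑ i, Measure.dirac (x i) :=
    congrArg Subtype.val (dif_pos hn)
  rw [h, integral_smul_measure, integral_finsetSum_measure fun i _ => integrable_dirac (by simp)]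
  simp

lemma mmdSq_empMeas_left {X : Type*} [MeasurableSpace X] [MeasurableSingletonClass X] [Nonempty X]
    (k : X → X → ℝ) (P : Measure X) {n : ℕ} (hn : 0 < n) (x : Fin n → X) :
    mmdSq k (empMeas n x : Measure X) P
      = (n : ℝ)⁻¹ * ((n : ℝ)⁻¹ * ∑ i, ∑ j, k (x i) (x j)) + (∫ y, ∫ y', k y y' ∂P ∂P)
        - 2 * ((n : ℝ)⁻¹ * ∑ i, ∫ y, k (x i) y ∂P) := by
  simp only [mmdSq, integral_empMeas hn, Finset.mul_sum]

/-- The unbiased statistic differs from the squared MMD to the empirical measure by at most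
`K / n`. -/
lemma abs_duSqSimple_sub_mmdSq_le {X : Type*} [MeasurableSpace X] [MeasurableSingletonClass X]
    [Nonempty X] (k : X → X → ℝ) {K : ℝ} (hk : ∀ x y, k x y ∈ Set.Icc (0 : ℝ) K)
    (P : Measure X) {n : ℕ} (hn : 2 ≤ n) (x : Fin n → X) :
    |duSqSimple k P x - mmdSq k (empMeas n x : Measure X) P| ≤ K / n := by
  have hn2 : (2 : ℝ) ≤ n := by exact_mod_cast hn
  rw [mmdSq_empMeas_left k P (by lia)]
  set S := ∑ i, ∑ j ∈ Finset.univ.filter (fun j => j ≠ i), k (x i) (x j) with hS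
  set T := ∑ i, k (x i) (x i) with hT
  have hsum : ∑ i, ∑ j, k (x i) (x j) = S + T := by
    rw [hS, hT, ← Finset.sum_add_distrib]
    refine Finset.sum_congr rfl fun i _ => ?_
    rw [← Finset.sum_filter_add_sum_filter_not Finset.univ (fun j => j ≠ i)]
    congr 1
    simp [Finset.filter_eq']
  have hS0 : 0 ≤ S := Finset.sum_nonneg fun i _ => Finset.sum_nonneg fun j _ => (hk _ _).1
  have hT0 : 0 ≤ T := Finset.sum_nonneg fun i _ => (hk _ _).1
  have hT1 : T ≤ n * K := by
    refine (Finset.sum_le_card_nsmul _ _ K fun i _ => (hk _ _).2).trans ?_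
    simp
  have hS1 : S ≤ n * ((n - 1) * K) := by
    refine (Finset.sum_le_card_nsmul _ _ (((n : ℝ) - 1) * K) fun i _ => ?_).trans ?_
    · refine (Finset.sum_le_card_nsmul _ _ K fun j _ => (hk _ _).2).trans ?_
      rw [Finset.filter_ne', Finset.card_erase_of_mem (Finset.mem_univ i), nsmul_eq_mul]
      simp [Nat.cast_sub (show 1 ≤ n by lia)]
    · simp
  have hdiff : duSqSimple k P x - ((n : ℝ)⁻¹ * ((n : ℝ)⁻¹ * ∑ i, ∑ j, k (x i) (x j))
      + (∫ y, ∫ y', k y y' ∂P ∂P) - 2 * ((n : ℝ)⁻¹ * ∑ i, ∫ y, k (x i) y ∂P))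
      = S / ((n : ℝ) ^ 2 * (n - 1)) - T / (n : ℝ) ^ 2 := by
    rw [hsum, duSqSimple, ← hS]
    have : (n : ℝ) - 1 ≠ 0 := by linarith
    have : (n : ℝ) ≠ 0 := by linarith
    field_simp
    ring
  have hn1 : (0 : ℝ) < n - 1 := by linarith
  have hn0 : (0 : ℝ) < n := by linarith
  have h1 : S / ((n : ℝ) ^ 2 * (n - 1)) ≤ K / n := by
    rw [div_le_div_iff₀ (by positivity) hn0]
    nlinarith
  have h2 : T / (n : ℝ) ^ 2 ≤ K / n := by
    rw [div_le_div_iff₀ (by positivity) hn0]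
    nlinarith
  have h3 : 0 ≤ S / ((n : ℝ) ^ 2 * (n - 1)) := by positivity
  have h4 : 0 ≤ T / (n : ℝ) ^ 2 := by positivity
  rw [hdiff, abs_le]
  constructor <;> linarith

/-- Empirical measures of samples that differ in one point are close in MMD. -/
lemma mmd_empMeas_le {X : Type*} [MeasurableSpace X] [MeasurableSingletonClass X]
    [Nonempty X] (k : X → X → ℝ) (hk_symm : ∀ x y, k x y = k y x) {K : ℝ}
    (hk : ∀ x y, k x y ∈ Set.Icc (0 : ℝ) K) {n : ℕ} (hn : 0 < n) (x y : Fin n → X) (i : Fin n)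
    (hxy : ∀ j, j ≠ i → x j = y j) :
    mmd k (empMeas n x : Measure X) (empMeas n y : Measure X)
      ≤ Real.sqrt (2 * K / (n : ℝ) ^ 2) := by
  refine Real.sqrt_le_sqrt ?_
  have hswap : ∑ p, ∑ q, k (y p) (x q) = ∑ p, ∑ q, k (x p) (y q) := by
    rw [Finset.sum_comm]
    exact Finset.sum_congr rfl fun p _ => Finset.sum_congr rfl fun q _ => hk_symm _ _
  have hsum : ∑ p, ∑ q, (k (x p) (x q) - k (x p) (y q) - k (y p) (x q) + k (y p) (y q))
      = k (x i) (x i) - k (x i) (y i) - k (y i) (x i) + k (y i) (y i) := by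
    rw [Finset.sum_eq_single i, Finset.sum_eq_single i]
    · intro q _ hq
      rw [hxy q hq]; ring
    · simp
    · intro p _ hp
      refine Finset.sum_eq_zero fun q _ => ?_
      rw [hxy p hp]; ring
    · simp
  simp only [Finset.sum_add_distrib, Finset.sum_sub_distrib, hswap] at hsum
  have hmm : mmdSq k (empMeas n x : Measure X) (empMeas n y : Measure X)
      = (k (x i) (x i) - k (x i) (y i) - k (y i) (x i) + k (y i) (y i)) / (n : ℝ) ^ 2 := by
    rw [← hsum]
    simp only [mmdSq, integral_empMeas hn, ← Finset.mul_sum]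
    field_simp
    ring
  rw [hmm]
  gcongr
  linarith [(hk (x i) (x i)).2, (hk (y i) (y i)).2, (hk (x i) (y i)).1, (hk (y i) (x i)).1]

lemma map_pi_eval_prod {X : Type*} [MeasurableSpace X] (P : Measure X) [IsProbabilityMeasure P]
    {n : ℕ} {i j : Fin n} (hij : i ≠ j) :
    (Measure.pi fun _ : Fin n => P).map (fun x => (x i, x j)) = P.prod P := by
  rw [← Measure.infinitePi_eq_pi]
  exact Measure.infinitePi_map_eval_prod (P := fun _ : Fin n => P) hij

lemma measurable_integral_kernel {X : Type*} [MeasurableSpace X] (P : Measure X)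
    [IsProbabilityMeasure P] (k : X → X → ℝ) (hk : Measurable fun p : X × X => k p.1 p.2) :
    Measurable fun x => ∫ y, k x y ∂P :=
  hk.stronglyMeasurable.integral_prod_right.measurable

lemma measurable_mmdSq_empMeas {X : Type*} [MeasurableSpace X] [MeasurableSingletonClass X]
    [Nonempty X] (P : Measure X) [IsProbabilityMeasure P] (k : X → X → ℝ)
    (hk : Measurable fun p : X × X => k p.1 p.2) {n : ℕ} (hn : 0 < n) :
    Measurable fun x : Fin n → X => mmdSq k (empMeas n x : Measure X) P := by
  have h := measurable_integral_kernel P k hk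
  have hij : ∀ i j : Fin n, Measurable fun x : Fin n → X => k (x i) (x j) := fun i j =>
    hk.comp (f := fun x : Fin n → X => (x i, x j)) (by fun_prop)
  have hi : ∀ i : Fin n, Measurable fun x : Fin n → X => ∫ y, k (x i) y ∂P := fun i =>
    h.comp (measurable_pi_apply i)
  simp_rw [mmdSq_empMeas_left k P hn]
  exact ((((Finset.measurable_sum _ fun i _ => Finset.measurable_sum _ fun j _ => hij i j).const_mul
    _).const_mul _).add_const _).sub
    (((Finset.measurable_sum _ fun i _ => hi i).const_mul _).const_mul _)

lemma measurable_duSqSimple {X : Type*} [MeasurableSpace X] (P : Measure X)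
    [IsProbabilityMeasure P] (k : X → X → ℝ)
    (hk : Measurable fun p : X × X => k p.1 p.2) (n : ℕ) :
    Measurable fun x : Fin n → X => duSqSimple k P x := by
  have h := measurable_integral_kernel P k hk
  have hij : ∀ i j : Fin n, Measurable fun x : Fin n → X => k (x i) (x j) := fun i j =>
    hk.comp (f := fun x : Fin n → X => (x i, x j)) (by fun_prop)
  have hi : ∀ i : Fin n, Measurable fun x : Fin n → X => ∫ y, k (x i) y ∂P := fun i =>
    h.comp (measurable_pi_apply i)
  unfold duSqSimple
  exact (((Finset.measurable_sum _ fun i _ => Finset.measurable_sum _ fun j _ => hij i j).const_mul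
    _).add_const _).sub ((Finset.measurable_sum _ fun i _ => hi i).const_mul _)

/-- The expected squared MMD between a measure and its empirical measure. -/
lemma integral_mmdSq_empMeas_le {X : Type*} [MeasurableSpace X] [MeasurableSingletonClass X]
    [Nonempty X] (P : Measure X) [IsProbabilityMeasure P] (k : X → X → ℝ)
    (hkm : Measurable fun p : X × X => k p.1 p.2) {K : ℝ}
    (hk : ∀ x y, k x y ∈ Set.Icc (0 : ℝ) K) {n : ℕ} (hn : 0 < n) :
    ∫ x, mmdSq k (empMeas n x : Measure X) P ∂(Measure.pi fun _ : Fin n => P) ≤ K / n := by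
  set ν := Measure.pi fun _ : Fin n => P
  set M := ∫ y, ∫ y', k y y' ∂P ∂P with hM
  have hk_norm : ∀ x y, ‖k x y‖ ≤ K := fun x y => by
    rw [Real.norm_eq_abs, abs_of_nonneg (hk x y).1]; exact (hk x y).2
  have hij : ∀ i j : Fin n, Measurable fun x : Fin n → X => k (x i) (x j) := fun i j =>
    hkm.comp (f := fun x : Fin n → X => (x i, x j)) (by fun_prop)
  have hiji : ∀ i j : Fin n, Integrable (fun x : Fin n → X => k (x i) (x j)) ν := fun i j =>
    Integrable.of_bound (hij i j).aestronglyMeasurable K (ae_of_all _ fun x => hk_norm _ _)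
  have hu : Measurable fun x => ∫ y, k x y ∂P := measurable_integral_kernel P k hkm
  have hui : Integrable (fun x => ∫ y, k x y ∂P) P := by
    refine Integrable.of_bound hu.aestronglyMeasurable K (ae_of_all _ fun x => ?_)
    simpa using norm_integral_le_of_norm_le_const (μ := P) (ae_of_all _ fun y => hk_norm x y)
  have huii : ∀ i : Fin n, Integrable (fun x : Fin n → X => ∫ y, k (x i) y ∂P) ν := fun i =>
    (measurePreserving_eval (fun _ : Fin n => P) i).integrable_comp_of_integrable hui
  have hM0 : 0 ≤ M := integral_nonneg fun _ => integral_nonneg fun _ => (hk _ _).1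
  have hE : ∀ i j : Fin n, ∫ x, k (x i) (x j) ∂ν ≤ M + if i = j then K else 0 := by
    intro i j
    split_ifs with h
    · have : ∫ x, k (x i) (x j) ∂ν ≤ ∫ _, K ∂ν :=
        integral_mono (hiji i j) (integrable_const K) fun x => (hk _ _).2
      simp only [integral_const, probReal_univ, one_smul] at this
      linarith
    · rw [add_zero, hM, ← integral_prod (fun p : X × X => k p.1 p.2)
        (Integrable.of_bound hkm.aestronglyMeasurable K (ae_of_all _ fun p => hk_norm _ _)),
        ← map_pi_eval_prod P h, integral_map (by fun_prop) hkm.aestronglyMeasurable]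
  have hU : ∀ i : Fin n, ∫ x, ∫ y, k (x i) y ∂P ∂ν = M := fun i =>
    integral_comp_eval (X := fun _ : Fin n => X) (μ := fun _ => P) (i := i)
      (f := fun x => ∫ y, k x y ∂P) hu.aestronglyMeasurable
  have hS : ∑ i, ∑ j, ∫ x, k (x i) (x j) ∂ν ≤ (n : ℝ) * (n * M) + n * K := by
    refine (Finset.sum_le_sum fun i _ => Finset.sum_le_sum fun j _ => hE i j).trans ?_
    simp [Finset.sum_add_distrib]
  have hSi : Integrable (fun x : Fin n → X => ∑ i, ∑ j, k (x i) (x j)) ν :=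
    integrable_finsetSum _ fun i _ => integrable_finsetSum _ fun j _ => hiji i j
  have hsi : Integrable (fun x : Fin n → X => ∑ i, ∫ y, k (x i) y ∂P) ν :=
    integrable_finsetSum _ fun i _ => huii i
  have hA : Integrable (fun x : Fin n → X =>
      (n : ℝ)⁻¹ * ((n : ℝ)⁻¹ * ∑ i, ∑ j, k (x i) (x j))) ν := (hSi.const_mul _).const_mul _
  have hAM : Integrable (fun x : Fin n → X =>
      (n : ℝ)⁻¹ * ((n : ℝ)⁻¹ * ∑ i, ∑ j, k (x i) (x j)) + M) ν := hA.add (integrable_const _)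
  have hB : Integrable (fun x : Fin n → X =>
      2 * ((n : ℝ)⁻¹ * ∑ i, ∫ y, k (x i) y ∂P)) ν := (hsi.const_mul _).const_mul _
  simp_rw [mmdSq_empMeas_left k P hn, ← hM]
  rw [integral_sub hAM hB, integral_add hA (integrable_const _)]
  simp only [integral_const_mul, integral_const, probReal_univ, one_smul]
  rw [integral_finsetSum _ fun i _ => integrable_finsetSum _ fun j _ => hiji i j,
    integral_finsetSum _ fun i _ => huii i]
  simp_rw [integral_finsetSum _ fun j _ => hiji _ j, hU]
  simp only [Finset.sum_const, Finset.card_univ, Fintype.card_fin, nsmul_eq_mul]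
  have hn0 : (0 : ℝ) < n := by exact_mod_cast hn
  calc _ ≤ (n : ℝ)⁻¹ * ((n : ℝ)⁻¹ * ((n : ℝ) * (n * M) + n * K)) + M
        - 2 * ((n : ℝ)⁻¹ * (n * M)) := by gcongr
    _ = K / n := by field_simp; ring

lemma le_expRate {n : ℕ} (hn : 0 < n) {p : ℝ≥0∞} {a : ℝ}
    (h : p ≤ ENNReal.ofReal (Real.exp (-(n * a)))) : (a : EReal) ≤ expRate n p := by
  have h1 := ENNReal.log_monotone h
  rw [ENNReal.log_ofReal_of_pos (Real.exp_pos _), Real.log_exp] at h1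
  rw [expRate, EReal.le_neg, ← EReal.coe_neg]
  have hn0 : (0 : ℝ) < n := by exact_mod_cast hn
  have h2 : ((-a : ℝ) : EReal) = (((n : ℝ)⁻¹ : ℝ) : EReal) * ((-(n * a) : ℝ) : EReal) := by
    rw [← EReal.coe_mul]
    congr 1
    field_simp
  rw [h2]
  exact mul_le_mul_of_nonneg_left h1 (EReal.coe_nonneg.2 (by positivity))

lemma expRate_le {n : ℕ} (hn : 0 < n) {p : ℝ≥0∞} {a : ℝ}
    (h : ENNReal.ofReal (Real.exp (-(n * a))) ≤ p) : expRate n p ≤ (a : EReal) := by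
  have h1 := ENNReal.log_monotone h
  rw [ENNReal.log_ofReal_of_pos (Real.exp_pos _), Real.log_exp] at h1
  rw [expRate, EReal.neg_le, ← EReal.coe_neg]
  have hn0 : (0 : ℝ) < n := by exact_mod_cast hn
  have h2 : ((-a : ℝ) : EReal) = (((n : ℝ)⁻¹ : ℝ) : EReal) * ((-(n * a) : ℝ) : EReal) := by
    rw [← EReal.coe_mul]
    congr 1
    field_simp
  rw [h2]
  exact mul_le_mul_of_nonneg_left h1 (EReal.coe_nonneg.2 (by positivity))

/-- If the MMD separates probability measures, its square is nonnegative. -/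
lemma mmdSq_nonneg_of_separates {X : Type*} [MeasurableSpace X] (k : X → X → ℝ)
    (h_sep : ∀ R S : ProbabilityMeasure X,
      mmd k (R : Measure X) (S : Measure X) = 0 ↔ R = S) (R S : ProbabilityMeasure X) :
    0 ≤ mmdSq k (R : Measure X) (S : Measure X) := by
  by_contra! h
  obtain rfl := (h_sep R S).1 (Real.sqrt_eq_zero_of_nonpos h.le)
  have : mmdSq k (R : Measure X) (R : Measure X) = 0 := by
    rw [mmdSq]; ring
  linarith

/-- The level of the unbiased simple kernel test. -/
lemma measure_pi_duSqSimple_gt_le {X : Type*} [MeasurableSpace X] [MeasurableSingletonClass X]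
    [Nonempty X] (k : X → X → ℝ) (hkm : Measurable fun p : X × X => k p.1 p.2)
    (hk_symm : ∀ x y, k x y = k y x) {K : ℝ} (hK : 0 < K)
    (hk : ∀ x y, k x y ∈ Set.Icc (0 : ℝ) K)
    (h_sep : ∀ R S : ProbabilityMeasure X,
      mmd k (R : Measure X) (S : Measure X) = 0 ↔ R = S)
    (h_tri : ∀ R S T : ProbabilityMeasure X,
      mmd k (R : Measure X) (T : Measure X)
        ≤ mmd k (R : Measure X) (S : Measure X) + mmd k (S : Measure X) (T : Measure X))
    (P : ProbabilityMeasure X) {α : ℝ} (hα0 : 0 < α) (hα1 : α < 1) {n : ℕ} (hn : 2 ≤ n) :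
    Measure.pi (fun _ : Fin n => (P : Measure X))
        {x | (Real.sqrt (2 * K / n) * (1 + Real.sqrt (Real.log (1 / α)))) ^ 2 + K / n
          < duSqSimple k (P : Measure X) x} ≤ ENNReal.ofReal α := by
  have hn' : 0 < n := by lia
  have hn0 : (0 : ℝ) < n := by exact_mod_cast hn'
  set ν := Measure.pi fun _ : Fin n => (P : Measure X)
  set v : ℝ := 2 * K / n with hv
  set L : ℝ := Real.log (1 / α) with hL
  have hv0 : 0 < v := by positivity
  have hL0 : 0 < L := Real.log_pos (by rw [lt_div_iff₀ hα0]; linarith)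
  set G : (Fin n → X) → ℝ := fun x => mmdSq k (empMeas n x : Measure X) P with hG
  set F : (Fin n → X) → ℝ := fun x => mmd k (empMeas n x : Measure X) P with hF
  have hG0 : ∀ x, 0 ≤ G x := fun x => mmdSq_nonneg_of_separates k h_sep _ _
  have hFsq : ∀ x, F x ^ 2 = G x := fun x => Real.sq_sqrt (hG0 x)
  have hF0 : ∀ x, 0 ≤ F x := fun x => Real.sqrt_nonneg _
  have hGm : Measurable G := measurable_mmdSq_empMeas (P : Measure X) k hkm hn'
  have hFm : Measurable F := hGm.sqrt
  have hd : ∀ x i a, F (Function.update x i a) ≤ F x + Real.sqrt (2 * K / (n : ℝ) ^ 2) ∧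
      F x ≤ F (Function.update x i a) + Real.sqrt (2 * K / (n : ℝ) ^ 2) := fun x i a => by
    have h1 := h_tri (empMeas n (Function.update x i a)) (empMeas n x) P
    have h2 := h_tri (empMeas n x) (empMeas n (Function.update x i a)) P
    have h3 := mmd_empMeas_le k hk_symm hk hn' (Function.update x i a) x i
      fun j hj => Function.update_of_ne hj _ _
    have h4 := mmd_empMeas_le k hk_symm hk hn' x (Function.update x i a) i
      fun j hj => (Function.update_of_ne hj _ _).symm
    constructor <;> simp only [F] <;> linarith
  have hGB : ∀ x, G x ≤ 2 * K := fun x => by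
    have hsum : ∑ i, ∑ j, k (x i) (x j) ≤ n * (n * K) := by
      refine (Finset.sum_le_sum fun i _ => Finset.sum_le_sum fun j _ => (hk _ _).2).trans ?_
      simp
    have h1 : (n : ℝ)⁻¹ * ((n : ℝ)⁻¹ * ∑ i, ∑ j, k (x i) (x j)) ≤ K := by
      calc _ ≤ (n : ℝ)⁻¹ * ((n : ℝ)⁻¹ * (n * (n * K))) := by gcongr
        _ = K := by field_simp
    have hb : ∀ y, ‖∫ y', k y y' ∂(P : Measure X)‖ ≤ K := fun y => by
      have := norm_integral_le_of_norm_le_const (μ := (P : Measure X)) (f := k y) (C := K)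
        (ae_of_all _ fun y' => by
          rw [Real.norm_eq_abs, abs_of_nonneg (hk _ _).1]; exact (hk _ _).2)
      simpa using this
    have h2 : ∫ y, ∫ y', k y y' ∂(P : Measure X) ∂(P : Measure X) ≤ K := by
      have := norm_integral_le_of_norm_le_const (μ := (P : Measure X)) (ae_of_all _ hb)
      exact (le_abs_self _).trans (by simpa using this)
    have h3 : 0 ≤ 2 * ((n : ℝ)⁻¹ * ∑ i, ∫ y, k (x i) y ∂(P : Measure X)) := by
      have : ∀ i, 0 ≤ ∫ y, k (x i) y ∂(P : Measure X) := fun i =>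
        integral_nonneg fun y => (hk _ _).1
      have := Finset.sum_nonneg fun i (_ : i ∈ Finset.univ) => this i
      positivity
    simp only [G]
    rw [mmdSq_empMeas_left k (P : Measure X) hn']
    linarith
  have hFB : ∀ x, |F x| ≤ Real.sqrt (2 * K) := fun x => by
    rw [abs_of_nonneg (hF0 x)]
    exact Real.sqrt_le_sqrt (hGB x)
  have hmean : ∫ x, F x ∂ν ≤ Real.sqrt v := by
    refine Real.le_sqrt_of_sq_le ?_
    have hLp : MemLp F 2 ν := MemLp.of_bound hFm.aestronglyMeasurable _ (ae_of_all _ hFB)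
    have h1 := ProbabilityTheory.variance_nonneg F ν
    rw [ProbabilityTheory.variance_eq_sub hLp] at h1
    have h2 : ∫ x, (F ^ 2) x ∂ν ≤ K / n := by
      simp only [Pi.pow_apply, hFsq]
      exact integral_mmdSq_empMeas_le (P : Measure X) k hkm hk hn'
    have h3 : K / n ≤ v := by
      rw [hv]
      gcongr
      linarith
    linarith
  have hmcd := measure_pi_ge_le_of_bounded_differences (P : Measure X)
    (Real.sqrt (2 * K / (n : ℝ) ^ 2)) (s := 4 * (Real.sqrt v * Real.sqrt L) / v) (by positivity)
    (Real.sqrt (2 * K)) (Real.sqrt v * Real.sqrt L) n F hFm hFB fun x i a =>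
      abs_le.2 ⟨by linarith [(hd x i a).2], by linarith [(hd x i a).1]⟩
  have hvn : (n : ℝ) * Real.sqrt (2 * K / (n : ℝ) ^ 2) ^ 2 = v := by
    rw [Real.sq_sqrt (by positivity), hv]
    field_simp
  have hexp : -(4 * (Real.sqrt v * Real.sqrt L) / v) * (Real.sqrt v * Real.sqrt L)
      + (4 * (Real.sqrt v * Real.sqrt L) / v) ^ 2
        * (n * Real.sqrt (2 * K / (n : ℝ) ^ 2) ^ 2) / 8 = -(2 * L) := by
    have h1 : (Real.sqrt v * Real.sqrt L) ^ 2 = v * L := by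
      rw [mul_pow, Real.sq_sqrt hv0.le, Real.sq_sqrt hL0.le]
    rw [hvn]
    set τ := Real.sqrt v * Real.sqrt L
    have h2 : -(4 * τ / v) * τ + (4 * τ / v) ^ 2 * v / 8 = -(2 * τ ^ 2 / v) := by
      field_simp
      ring
    rw [h2, h1]
    field_simp
  rw [hexp] at hmcd
  have hα : Real.exp (-(2 * L)) ≤ α := by
    have : Real.exp (-L) = α := by
      rw [hL, one_div, Real.log_inv, neg_neg, Real.exp_log hα0]
    rw [← this]
    exact Real.exp_le_exp.2 (by linarith)
  refine (measure_mono ?_).trans (hmcd.trans (ENNReal.ofReal_le_ofReal hα))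
  intro x hx
  rw [Set.mem_ofPred_eq] at hx ⊢
  have h1 := (abs_le.1 (abs_duSqSimple_sub_mmdSq_le k hk (P : Measure X) hn x)).2
  have h2 : (Real.sqrt v * (1 + Real.sqrt L)) ^ 2 < F x ^ 2 := by
    rw [hFsq]
    simp only [G]
    linarith
  have h3 := lt_of_pow_lt_pow_left₀ 2 (hF0 x) h2
  linarith

/-- The Sanov-type bound: the type-II error exponent is at least the divergence. -/
lemma eventually_le_expRate_duSqSimple {X : Type*} [MeasurableSpace X] [TopologicalSpace X]
    [PolishSpace X] [BorelSpace X] [Nonempty X] (k : X → X → ℝ) {K : ℝ}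
    (hk : ∀ x y, k x y ∈ Set.Icc (0 : ℝ) K)
    (h_metrize : ∀ s : Set (ProbabilityMeasure X),
      IsOpen s ↔ ∀ R ∈ s, ∃ ε > 0,
        ∀ S : ProbabilityMeasure X, mmd k (S : Measure X) (R : Measure X) < ε → S ∈ s)
    (P Q : ProbabilityMeasure X) (hPQ : (P : Measure X) ≪ Q)
    (hint : Integrable (llr (P : Measure X) Q) P) {t : ℕ → ℝ} (ht : Tendsto t atTop (𝓝 0))
    {z : ℝ} (hz : z < ∫ x, llr (P : Measure X) Q x ∂P) :
    ∀ᶠ n : ℕ in atTop, (z : EReal) ≤ expRate n (Measure.pi (fun _ : Fin n => (Q : Measure X))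
      {x | duSqSimple k (P : Measure X) x ≤ t n}) := by
  set D := ∫ x, llr (P : Measure X) Q x ∂P
  obtain ⟨f, hf1, hf2⟩ := exists_boundedContinuous_integral_llr_le (P : Measure X) Q hPQ hint
    (δ := (D - z) / 3) (by linarith)
  set δ := (D - z) / 3 with hδ
  have hδ0 : 0 < δ := by rw [hδ]; linarith
  have hopen : IsOpen {R : ProbabilityMeasure X | ∫ x, f x ∂(P : Measure X) - δ
      < ∫ x, f x ∂(R : Measure X)} :=
    isOpen_lt continuous_const
      (ProbabilityMeasure.continuous_integral_boundedContinuousFunction f)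
  obtain ⟨ε, hε, hball⟩ := (h_metrize _).1 hopen P (sub_lt_self _ hδ0)
  have hlim : Tendsto (fun n : ℕ => t n + K / n) atTop (𝓝 0) := by
    simpa using ht.add (tendsto_const_div_atTop_nhds_zero_nat K)
  filter_upwards [hlim.eventually (gt_mem_nhds (pow_pos hε 2)), eventually_ge_atTop 2] with n hnε hn
  have hn' : 0 < n := by lia
  have hn0 : (0 : ℝ) < n := by exact_mod_cast hn'
  have hexpi : Integrable (fun x => Real.exp (f x)) (Q : Measure X) := by
    refine Integrable.of_bound (by fun_prop) (Real.exp ‖f‖) (ae_of_all _ fun x => ?_)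
    rw [Real.norm_eq_abs, abs_of_pos (Real.exp_pos _), Real.exp_le_exp]
    exact (le_abs_self _).trans (f.norm_coe_le_norm x)
  refine le_expRate hn' ((measure_mono ?_).trans ((measure_pi_sum_ge_le (Q : Measure X) hexpi
    (n * (∫ x, f x ∂(P : Measure X) - δ)) n).trans (ENNReal.ofReal_le_ofReal ?_)))
  · intro x hx
    rw [Set.mem_ofPred_eq] at hx ⊢
    have h1 := (abs_le.1 (abs_duSqSimple_sub_mmdSq_le k hk (P : Measure X) hn x)).1
    have h2 : mmd k (empMeas n x : Measure X) P < ε :=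
      (Real.sqrt_lt' hε).2 (by linarith)
    have h3 := hball _ h2
    rw [Set.mem_ofPred_eq, integral_empMeas hn', inv_mul_eq_div, lt_div_iff₀ hn0] at h3
    linarith
  · calc _ ≤ Real.exp (-(n * (∫ x, f x ∂(P : Measure X) - δ))) * Real.exp δ ^ n := by
          have h0 : 0 ≤ ∫ x, Real.exp (f x) ∂(Q : Measure X) :=
            integral_nonneg fun x => (Real.exp_pos _).le
          gcongr
          linarith [Real.add_one_le_exp δ]
      _ ≤ Real.exp (-(n * z)) := by
          rw [← Real.exp_nat_mul, ← Real.exp_add, Real.exp_le_exp]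
          have : z ≤ ∫ x, f x ∂(P : Measure X) - δ - δ := by linarith
          have := mul_le_mul_of_nonneg_left this hn0.le
          linarith

/-- The Stein-type converse: the type-II error exponent of any sequence of tests of level
`α < 1` is at most the divergence. -/
lemma eventually_expRate_le_of_level {X : Type*} [MeasurableSpace X] (P Q : Measure X)
    [IsProbabilityMeasure P] [IsProbabilityMeasure Q] (hPQ : P ≪ Q)
    (hint : Integrable (llr P Q) P) {α : ℝ} (hα0 : 0 < α) (hα1 : α < 1)
    {A : ∀ n : ℕ, Set (Fin n → X)} (hA : ∀ n, MeasurableSet (A n))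
    (hlevel : ∀ n, 2 ≤ n → (Measure.pi fun _ : Fin n => P) (A n)ᶜ ≤ ENNReal.ofReal α)
    {z : ℝ} (hz : ∫ x, llr P Q x ∂P < z) :
    ∀ᶠ n : ℕ in atTop, expRate n ((Measure.pi fun _ : Fin n => Q) (A n)) ≤ (z : EReal) := by
  set D := ∫ x, llr P Q x ∂P
  obtain ⟨c, hc1, hc2⟩ := exists_between hz
  have hβ : 0 < (1 - α) / 2 := by linarith
  have hlln := tendsto_measure_pi_sum_gt P (measurable_llr P Q) hint hc1
  have hexp : Tendsto (fun n : ℕ => Real.exp (-(n * (z - c)))) atTop (𝓝 0) :=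
    Real.tendsto_exp_neg_atTop_nhds_zero.comp
      (tendsto_natCast_atTop_atTop.atTop_mul_const (sub_pos.2 hc2))
  filter_upwards [hlln.eventually (gt_mem_nhds (ENNReal.ofReal_pos.2 hβ)),
    hexp.eventually (gt_mem_nhds hβ), eventually_ge_atTop 2] with n h1 h2 hn
  refine expRate_le (by lia) ?_
  set q := (Measure.pi fun _ : Fin n => Q) (A n) with hq
  have hcover : (1 : ℝ≥0∞) ≤ ENNReal.ofReal α + ENNReal.ofReal ((1 - α) / 2)
      + ENNReal.ofReal (Real.exp (n * c)) * q := by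
    calc (1 : ℝ≥0∞) = (Measure.pi fun _ : Fin n => P) Set.univ := measure_univ.symm
      _ ≤ (Measure.pi fun _ : Fin n => P) (((A n)ᶜ ∪ {x | n * c < ∑ i, llr P Q (x i)})
          ∪ (A n ∩ {x | ∑ i, llr P Q (x i) ≤ n * c})) := by
        refine measure_mono fun x _ => ?_
        by_cases hx : x ∈ A n
        · rcases lt_or_ge (n * c) (∑ i, llr P Q (x i)) with h | h
          · exact Or.inl (Or.inr h)
          · exact Or.inr ⟨hx, h⟩
        · exact Or.inl (Or.inl hx)
      _ ≤ _ := by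
        refine (measure_union_le _ _).trans (add_le_add ((measure_union_le _ _).trans
          (add_le_add (hlevel n hn) h1.le)) ?_)
        exact measure_pi_inter_llr_le P Q hPQ n c (hA n)
  have hqt : q ≠ ⊤ := measure_ne_top _ _
  rw [← ENNReal.ofReal_toReal hqt, ← ENNReal.ofReal_mul (Real.exp_pos _).le,
    ← ENNReal.ofReal_add hα0.le hβ.le, ← ENNReal.ofReal_add (by linarith) (by positivity),
    ENNReal.one_le_ofReal] at hcover
  rw [← ENNReal.ofReal_toReal hqt]
  refine ENNReal.ofReal_le_ofReal ?_
  calc Real.exp (-(n * z)) = Real.exp (-(n * c)) * Real.exp (-(n * (z - c))) := by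
        rw [← Real.exp_add]; ring_nf
    _ ≤ Real.exp (-(n * c)) * (Real.exp (n * c) * q.toReal) := by
        gcongr
        linarith
    _ = q.toReal := by rw [← mul_assoc, ← Real.exp_add]; simp

/-- The unbiased simple MMD kernel test `d_u²(P, Q̂_n) ≤ γ_n² + K/n` with
`γ_n = sqrt(2K/n)(1 + sqrt(log(1/α)))` is a level-`α` asymptotically optimal test for
universal hypothesis testing: under `H₀ : Q = P` its type-I error probability is at most `α`
for every `n ≥ 2`, and under `H₁` with `0 < D(P‖Q) < ∞` its type-II error exponent is
`D(P‖Q)`. -/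
theorem mmd_unbiased_simple_test_optimal {X : Type*} [MeasurableSpace X] [TopologicalSpace X]
    [PolishSpace X] [LocallyCompactSpace X] [T2Space X] [BorelSpace X] [Nonempty X]
    (k : X → X → ℝ) (hk_cont : Continuous fun p : X × X => k p.1 p.2)
    (hk_symm : ∀ x y, k x y = k y x)
    (hk_psd : ∀ (N : ℕ) (z : Fin N → X) (c : Fin N → ℝ),
      0 ≤ ∑ i, ∑ j, c i * c j * k (z i) (z j))
    (K : ℝ) (hK : 0 < K) (hk_bdd : ∀ x y, k x y ∈ Set.Icc (0 : ℝ) K)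
    (h_sep : ∀ R S : ProbabilityMeasure X,
      mmd k (R : Measure X) (S : Measure X) = 0 ↔ R = S)
    (h_tri : ∀ R S T : ProbabilityMeasure X,
      mmd k (R : Measure X) (T : Measure X)
        ≤ mmd k (R : Measure X) (S : Measure X) + mmd k (S : Measure X) (T : Measure X))
    (h_metrize : ∀ s : Set (ProbabilityMeasure X),
      IsOpen s ↔ ∀ R ∈ s, ∃ ε > 0,
        ∀ S : ProbabilityMeasure X, mmd k (S : Measure X) (R : Measure X) < ε → S ∈ s)
    (P Q : ProbabilityMeasure X) {α : ℝ} (hα0 : 0 < α) (hα1 : α < 1)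
    (γ : ℕ → ℝ)
    (hγ : ∀ n : ℕ, γ n = Real.sqrt (2 * K / n) * (1 + Real.sqrt (Real.log (1 / α)))) :
    (Q = P → ∀ n : ℕ, 2 ≤ n →
      Measure.pi (fun _ : Fin n => (P : Measure X))
          {x | γ n ^ 2 + K / n < duSqSimple k (P : Measure X) x}
        ≤ ENNReal.ofReal α)
    ∧ (0 < klDiv (P : Measure X) (Q : Measure X) →
        klDiv (P : Measure X) (Q : Measure X) < ⊤ →
        liminf (fun n : ℕ => expRate n
            (Measure.pi (fun _ : Fin n => (Q : Measure X))
              {x | duSqSimple k (P : Measure X) x ≤ γ n ^ 2 + K / n})) atTop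
          = ((klDiv (P : Measure X) (Q : Measure X) : ℝ≥0∞) : EReal)) := by
  have hkm : Measurable fun p : X × X => k p.1 p.2 := hk_cont.measurable
  have hlevel : ∀ n : ℕ, 2 ≤ n → Measure.pi (fun _ : Fin n => (P : Measure X))
      {x | γ n ^ 2 + K / n < duSqSimple k (P : Measure X) x} ≤ ENNReal.ofReal α := fun n hn => by
    rw [hγ]
    exact measure_pi_duSqSimple_gt_le k hkm hk_symm hK hk_bdd h_sep h_tri P hα0 hα1 hn
  refine ⟨fun _ => hlevel, fun hpos hfin => ?_⟩
  rw [klDiv] at hpos hfin ⊢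
  split_ifs at hpos hfin ⊢ with h
  · obtain ⟨hPQ, hint⟩ := h
    rw [EReal.coe_ennreal_ofReal, max_eq_left (ENNReal.ofReal_pos.1 hpos).le]
    have ht : Tendsto (fun n : ℕ => γ n ^ 2 + K / n) atTop (𝓝 0) := by
      have h1 : Tendsto γ atTop (𝓝 0) := by
        rw [funext hγ]
        simpa using (tendsto_const_div_atTop_nhds_zero_nat (2 * K)).sqrt.mul_const
          (1 + Real.sqrt (Real.log (1 / α)))
      simpa using (h1.pow 2).add (tendsto_const_div_atTop_nhds_zero_nat K)
    refine Tendsto.liminf_eq (tendsto_order.2 ⟨fun a ha => ?_, fun b hb => ?_⟩)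
    · obtain ⟨z, haz, hz⟩ := EReal.lt_iff_exists_real_btwn.1 ha
      filter_upwards [eventually_le_expRate_duSqSimple k hk_bdd h_metrize P Q hPQ hint ht
        (EReal.coe_lt_coe_iff.1 hz)] with n hn
      exact haz.trans_le hn
    · obtain ⟨z, hz, hzb⟩ := EReal.lt_iff_exists_real_btwn.1 hb
      filter_upwards [eventually_expRate_le_of_level (P : Measure X) (Q : Measure X) hPQ hint
        hα0 hα1 (A := fun n => {x | duSqSimple k (P : Measure X) x ≤ γ n ^ 2 + K / n})
        (fun n => measurableSet_le (measurable_duSqSimple (P : Measure X) k hkm n)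
          measurable_const)
        (fun n hn => by simpa only [Set.compl_ofPred, not_le] using hlevel n hn)
        (EReal.coe_lt_coe_iff.1 hz)] with n hn
      exact hn.trans_lt hzb
  · exact absurd hfin (lt_irrefl _)
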